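/- Let p be an odd prime and let E: y² = x(x-1)(x-t) be a supersingular elliptic curve over an algebraic closure of F_p with t ∈ F_{p²}. Then t, 1-t, and -t are fourth powers in F_{p²}. -/

import Mathlib

section

open Polynomial WeierstrassCurve WeierstrassCurve.Affine

/-- The Legendre curve `y² = x(x - 1)(x - t)`. -/
def legendreCurve {F : Type*} [Field F] (t : F) : WeierstrassCurve F :=
  ⟨0, -(1 + t), 0, t, 0⟩

namespace legendreCurve

variable {F K : Type*} [Field F] [Field K] [Algebra F K] (t : F)

lemma a₁_baseChange : ((legendreCurve t)⁄K).a₁ = 0 := map_zero (algebraMap F K)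

lemma a₂_baseChange : ((legendreCurve t)⁄K).a₂ = -(1 + algebraMap F K t) := by
  simp [legendreCurve]

lemma a₃_baseChange : ((legendreCurve t)⁄K).a₃ = 0 := map_zero (algebraMap F K)

lemma a₄_baseChange : ((legendreCurve t)⁄K).a₄ = algebraMap F K t := rfl

lemma a₆_baseChange : ((legendreCurve t)⁄K).a₆ = 0 := map_zero (algebraMap F K)

lemma negY_eq (x y : K) : ((legendreCurve t)⁄K).negY x y = -y := by
  rw [negY, a₁_baseChange, a₃_baseChange]
  ring

lemma equation_iff {x y : K} : ((legendreCurve t)⁄K).Equation x y ↔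
    y ^ 2 = x * (x - 1) * (x - algebraMap F K t) := by
  rw [Affine.equation_iff]
  simp only [a₁_baseChange, a₂_baseChange, a₃_baseChange, a₄_baseChange, a₆_baseChange]
  constructor <;> intro h <;> linear_combination h

variable {t}

lemma nonsingular_of_sq_eq (h2 : (2 : K) ≠ 0) (ht0 : t ≠ 0) (ht1 : t ≠ 1) {x y : K}
    (h : y ^ 2 = x * (x - 1) * (x - algebraMap F K t)) :
    ((legendreCurve t)⁄K).Nonsingular x y := by
  have hT0 : algebraMap F K t ≠ 0 := by simpa using ht0
  have hT1 : algebraMap F K t ≠ 1 := by simpa using ht1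
  rw [Affine.nonsingular_iff, equation_iff]
  simp only [a₁_baseChange, a₂_baseChange, a₃_baseChange, a₄_baseChange]
  refine ⟨h, ?_⟩
  by_contra! hc
  have hy : y = 0 := by
    have : 2 * y = 0 := by linear_combination hc.2
    simpa [h2] using this
  have h1 := hc.1
  rw [hy] at h
  have h3 : x = 0 ∨ x = 1 ∨ x = algebraMap F K t := by
    have : x * (x - 1) * (x - algebraMap F K t) = 0 := by rw [← h]; ring
    simpa [sub_eq_zero, or_assoc] using this
  rcases h3 with rfl | rfl | rfl
  · exact hT0 (by linear_combination -h1)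
  · exact hT1 (by linear_combination h1)
  · have : algebraMap F K t * (algebraMap F K t - 1) = 0 := by linear_combination -h1
    simp [hT0, sub_eq_zero, hT1] at this

variable [DecidableEq K]

lemma xRep_add_sub (h2 : (2 : K) ≠ 0) {x y : K}
    (h : ((legendreCurve t)⁄K).Nonsingular x y) (R : ((legendreCurve t)⁄K).Point) :
    ∃ d : K, d ≠ 0 ∧
      (x * R.xRep 0 - algebraMap F K t * R.xRep 1) ^ 2 =
        d * ((R + .some x y h).xRep 0 * (R - .some x y h).xRep 0) ∧
      2 * ((R.xRep 0 + x * R.xRep 1) * (algebraMap F K t * R.xRep 1 + x * R.xRep 0) -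
        2 * (1 + algebraMap F K t) * x * R.xRep 0 * R.xRep 1) =
        d * ((R + .some x y h).xRep 0 * (R - .some x y h).xRep 1 +
          (R + .some x y h).xRep 1 * (R - .some x y h).xRep 0) ∧
      (R.xRep 0 - x * R.xRep 1) ^ 2 =
        d * ((R + .some x y h).xRep 1 * (R - .some x y h).xRep 1) := by
  have hP := (equation_iff t).1 h.1
  have double : ∃ d : K, d ≠ 0 ∧
      (x ^ 2 - algebraMap F K t) ^ 2 =
        d * (Point.some x y h + .some x y h).xRep 0 ∧
      4 * (x * (x - 1) * (x - algebraMap F K t)) =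
        d * (Point.some x y h + .some x y h).xRep 1 := by
    by_cases hy : y = 0
    · refine ⟨(x ^ 2 - algebraMap F K t) ^ 2, ?_, ?_, ?_⟩
      · have hn := ((Affine.nonsingular_iff ..).1 h).2
        simp only [a₁_baseChange, a₂_baseChange, a₃_baseChange, a₄_baseChange] at hn
        contrapose! hn
        have hx : x ^ 2 = algebraMap F K t := by simpa [sub_eq_zero] using hn
        rw [hy, ← hx] at hP
        have hx' : x ^ 2 * (x - 1) ^ 2 = 0 := by linear_combination hP
        have : x * (x - 1) = 0 := by
          rw [← mul_pow] at hx'; simpa using hx'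
        rw [← hx, hy]
        constructor
        · rcases mul_eq_zero.1 this with h0 | h0
          · rw [h0]; ring
          · rw [sub_eq_zero.1 h0]; ring
        · ring
      · rw [Point.add_self_of_Y_eq (by rw [negY_eq, hy, neg_zero])]
        simp
      · rw [Point.add_self_of_Y_eq (by rw [negY_eq, hy, neg_zero]), ← hP, hy]
        simp
    · have hne : y ≠ ((legendreCurve t)⁄K).negY x y := by
        rw [negY_eq]
        intro hc
        have : 2 * y = 0 := by linear_combination hc
        simp [h2, hy] at this
      have h2y : y - -y ≠ 0 := by
        have : y - -y = 2 * y := by ring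
        simp [this, h2, hy]
      refine ⟨4 * y ^ 2, ?_, ?_, ?_⟩
      · have : (4 : K) = 2 * 2 := by norm_num
        simp [this, h2, hy]
      · rw [Point.add_self_of_Y_ne hne, Point.xRep_some, slope_of_Y_ne rfl hne]
        simp only [addX, negY_eq, a₁_baseChange, a₂_baseChange, a₄_baseChange,
          Matrix.cons_val_zero]
        have h2y' : y - -y = 2 * y := by ring
        rw [h2y']
        field_simp
        linear_combination -(16 * (1 + algebraMap F K t) - 32 * x) * hP
      · rw [Point.add_self_of_Y_ne hne, Point.xRep_some]
        simp [← hP]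
  match R with
  | 0 =>
    refine ⟨1, one_ne_zero, ?_⟩
    simp only [zero_add, zero_sub, Point.xRep_neg, Point.xRep_some, Point.xRep_zero]
    refine ⟨?_, ?_, ?_⟩ <;> simp <;> ring
  | .some x' y' h' =>
    by_cases hx : x' = x
    · obtain ⟨d, hd, h₁, h₂⟩ := double
      refine ⟨d, hd, ?_⟩
      rcases Point.X_eq_iff.1 hx with hR | hR
      · rw [hR, sub_self, Point.xRep_zero, Point.xRep_some]
        simp only [Matrix.cons_val_zero, Matrix.cons_val_one]
        refine ⟨?_, ?_, ?_⟩
        · linear_combination h₁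
        · linear_combination h₂
        · ring
      · have hs : -Point.some x y h - .some x y h = -(.some x y h + .some x y h) := by abel
        rw [hR, hs, neg_add_cancel, Point.xRep_zero, Point.xRep_neg, Point.xRep_neg,
          Point.xRep_some]
        simp only [Matrix.cons_val_zero, Matrix.cons_val_one]
        refine ⟨?_, ?_, ?_⟩
        · linear_combination h₁
        · linear_combination h₂
        · ring
    have hP' := (equation_iff t).1 h'.1
    have hd : x' - x ≠ 0 := sub_ne_zero.2 hx
    refine ⟨(x' - x) ^ 2, pow_ne_zero _ hd, ?_⟩
    rw [sub_eq_add_neg (Point.some x' y' h'), Point.neg_some, Point.add_of_X_ne hx,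
      Point.add_of_X_ne hx, Point.xRep_some, Point.xRep_some, Point.xRep_some, slope_of_X_ne hx, slope_of_X_ne hx]
    simp only [addX, negY_eq, a₁_baseChange, a₂_baseChange, Matrix.cons_val_zero,
      Matrix.cons_val_one]
    simp only [zero_mul, add_zero]
    have hc₁ : (x' - x) ^ 2 * (((y' - y) / (x' - x)) ^ 2 -
        -(1 + algebraMap F K t) - x' - x) =
        (y' - y) ^ 2 + (1 + algebraMap F K t - x' - x) * (x' - x) ^ 2 := by
      field_simp
      ring
    have hc₂ : (x' - x) ^ 2 * (((y' - -y) / (x' - x)) ^ 2 -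
        -(1 + algebraMap F K t) - x' - x) =
        (y' + y) ^ 2 + (1 + algebraMap F K t - x' - x) * (x' - x) ^ 2 := by
      field_simp
      ring
    refine ⟨?_, ?_, ?_⟩
    · refine mul_left_cancel₀ (pow_ne_zero 2 hd) ?_
      rw [← mul_assoc ((x' - x) ^ 2) _ (_ - _), hc₁, mul_left_comm, hc₂]
      linear_combination
        -((y' ^ 2 - y ^ 2) + (x' * (x' - 1) * (x' - algebraMap F K t) -
          x * (x - 1) * (x - algebraMap F K t)) +
          2 * (1 + algebraMap F K t - x' - x) * (x' - x) ^ 2) * hP' +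
        ((y' ^ 2 - y ^ 2) + (x' * (x' - 1) * (x' - algebraMap F K t) -
          x * (x - 1) * (x - algebraMap F K t)) -
          2 * (1 + algebraMap F K t - x' - x) * (x' - x) ^ 2) * hP
    · simp only [mul_one, one_mul]
      rw [mul_add ((x' - x) ^ 2), hc₁, hc₂]
      linear_combination -2 * hP - 2 * hP'
    · ring

end legendreCurve

namespace legendreCurve

variable {F K : Type*} [Field F] [Field K] [Algebra F K] {t : F}

lemma exists_nonsingular [IsAlgClosed K] (h2 : (2 : K) ≠ 0) (ht0 : t ≠ 0) (ht1 : t ≠ 1) (x : K) :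
    ∃ y, ((legendreCurve t)⁄K).Nonsingular x y := by
  obtain ⟨y, hy⟩ := IsAlgClosed.exists_pow_nat_eq (x * (x - 1) * (x - algebraMap F K t)) two_pos
  exact ⟨y, nonsingular_of_sq_eq h2 ht0 ht1 hy⟩

variable [DecidableEq K]

/-- The polynomials `A` and `B` express multiplication by `n` on the `x`-line: the point `n • P` has
`x`-coordinate `A(x) / B(x)`, where `x` is the `x`-coordinate of `P`. -/
structure IsMulPair (t : F) (n : ℕ) (A B : K[X]) : Prop where
  monic : A.Monic
  natDegree_fst : A.natDegree = n ^ 2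
  natDegree_snd : B.natDegree < n ^ 2
  eval : ∀ (x y : K) (h : ((legendreCurve t)⁄K).Nonsingular x y), ∃ c : K, c ≠ 0 ∧
    A.eval x = c * (n • Point.some x y h).xRep 0 ∧ B.eval x = c * (n • Point.some x y h).xRep 1

lemma IsMulPair.isCoprime [IsAlgClosed K] (h2 : (2 : K) ≠ 0) (ht0 : t ≠ 0) (ht1 : t ≠ 1) {n : ℕ}
    {A B : K[X]} (hAB : IsMulPair t n A B) : IsCoprime A B := by
  rw [isCoprime_iff_aeval_ne_zero_of_isAlgClosed K K]
  intro x
  obtain ⟨y, hy⟩ := exists_nonsingular h2 ht0 ht1 x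
  obtain ⟨c, hc, hA, hB⟩ := hAB.eval x y hy
  by_contra! h
  simp only [coe_aeval_eq_eval] at h
  refine Point.xRep_ne_zero (n • Point.some x y hy) (funext fun i ↦ ?_)
  fin_cases i
  · simpa [hA, hc] using h.1
  · simpa [hB, hc] using h.2

lemma isMulPair_one : IsMulPair (K := K) t 1 X 1 where
  monic := monic_X
  natDegree_fst := by simp
  natDegree_snd := by simp
  eval x y h := ⟨1, one_ne_zero, by simp, by simp⟩

lemma isMulPair_two (h2 : (2 : K) ≠ 0) :
    IsMulPair (K := K) t 2 ((X ^ 2 - C (algebraMap F K t)) ^ 2)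
      (4 * (X * (X - 1) * (X - C (algebraMap F K t)))) where
  monic := (monic_X_pow_sub_C _ two_ne_zero).pow 2
  natDegree_fst := by simp
  natDegree_snd := by
    refine Nat.lt_of_le_of_lt (m := 3) ?_ (by norm_num)
    compute_degree
  eval x y h := by
    obtain ⟨d, hd, h₀, h₁, -⟩ := xRep_add_sub h2 h (.some x y h)
    rw [sub_self, Point.xRep_zero, Point.xRep_some] at h₀ h₁
    simp only [Matrix.cons_val_zero, Matrix.cons_val_one] at h₀ h₁
    refine ⟨d, hd, ?_, ?_⟩
    · simp only [two_smul, eval_pow, eval_sub, eval_X, eval_C]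
      linear_combination h₀
    · simp only [two_smul, eval_mul, eval_sub, eval_X, eval_C, eval_one, eval_ofNat]
      linear_combination h₁

lemma IsMulPair.exists_succ [IsAlgClosed K] (h2 : (2 : K) ≠ 0) (ht0 : t ≠ 0) (ht1 : t ≠ 1) {n : ℕ}
    (hn : n ≠ 0) {A₀ B₀ A B : K[X]} (h₀ : IsMulPair t n A₀ B₀) (h₁ : IsMulPair t (n + 1) A B) :
    ∃ A' B' : K[X], IsMulPair t (n + 2) A' B' := by
  set T := C (algebraMap F K t) with hT
  set S₀ := (X * A - T * B) ^ 2 with hS₀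
  set S₁ := 2 * ((A + X * B) * (T * B + X * A) - 2 * (1 + T) * X * A * B) with hS₁
  set S₂ := (A - X * B) ^ 2 with hS₂
  have key (x y : K) (h : ((legendreCurve t)⁄K).Nonsingular x y) : ∃ d e : K, d ≠ 0 ∧ e ≠ 0 ∧
      A₀.eval x = e * (n • Point.some x y h).xRep 0 ∧
      B₀.eval x = e * (n • Point.some x y h).xRep 1 ∧
      S₀.eval x = d * (((n + 2) • Point.some x y h).xRep 0 * (n • Point.some x y h).xRep 0) ∧
      S₁.eval x = d * (((n + 2) • Point.some x y h).xRep 0 * (n • Point.some x y h).xRep 1 +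
        ((n + 2) • Point.some x y h).xRep 1 * (n • Point.some x y h).xRep 0) ∧
      S₂.eval x = d * (((n + 2) • Point.some x y h).xRep 1 * (n • Point.some x y h).xRep 1) := by
    obtain ⟨e, he, hA₀, hB₀⟩ := h₀.eval x y h
    obtain ⟨c, hc, hA, hB⟩ := h₁.eval x y h
    obtain ⟨d, hd, e₀, e₁, e₂⟩ := xRep_add_sub h2 h ((n + 1) • .some x y h)
    have hadd : (n + 1) • Point.some x y h + .some x y h = (n + 2) • .some x y h := by
      rw [← succ_nsmul]
    have hsub : (n + 1) • Point.some x y h - .some x y h = n • .some x y h := by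
      rw [succ_nsmul, add_sub_cancel_right]
    rw [hadd, hsub] at e₀ e₁ e₂
    refine ⟨c ^ 2 * d, e, mul_ne_zero (pow_ne_zero _ hc) hd, he, hA₀, hB₀, ?_, ?_, ?_⟩
    · simp only [hS₀, hT, eval_pow, eval_sub, eval_mul, eval_X, eval_C, hA, hB]
      linear_combination c ^ 2 * e₀
    · simp only [hS₁, hT, eval_add, eval_sub, eval_mul, eval_X, eval_C, eval_one, eval_ofNat,
        hA, hB]
      linear_combination c ^ 2 * e₁
    · simp only [hS₂, eval_pow, eval_sub, eval_mul, eval_X, hA, hB]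
      linear_combination c ^ 2 * e₂
  have hident : S₀ * B₀ ^ 2 - S₁ * (A₀ * B₀) + S₂ * A₀ ^ 2 = 0 := by
    refine Polynomial.funext fun x ↦ ?_
    obtain ⟨y, hy⟩ := exists_nonsingular h2 ht0 ht1 x
    obtain ⟨d, e, -, -, hA₀, hB₀, hs₀, hs₁, hs₂⟩ := key x y hy
    simp only [eval_add, eval_sub, eval_mul, eval_pow, eval_zero, hA₀, hB₀, hs₀, hs₁, hs₂]
    ring
  have hcop := h₀.isCoprime h2 ht0 ht1
  have hB₀ : B₀ ≠ 0 := by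
    rintro rfl
    have := natDegree_eq_zero_of_isUnit (isCoprime_zero_right.1 hcop)
    rw [h₀.natDegree_fst] at this
    exact hn (by simpa using this)
  obtain ⟨A', hA'⟩ : A₀ ∣ S₀ := (hcop.pow_right (n := 2)).dvd_of_dvd_mul_right
    ⟨S₁ * B₀ - S₂ * A₀, by linear_combination hident⟩
  obtain ⟨B', hB'⟩ : B₀ ∣ S₂ := (hcop.symm.pow_right (n := 2)).dvd_of_dvd_mul_right
    ⟨S₁ * A₀ - S₀ * B₀, by linear_combination hident⟩
  have hsum : S₁ = A' * B₀ + B' * A₀ := by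
    refine mul_right_cancel₀ (mul_ne_zero h₀.monic.ne_zero hB₀) ?_
    linear_combination -hident + B₀ ^ 2 * hA' + A₀ ^ 2 * hB'
  have hdA : A.natDegree = n ^ 2 + 2 * n + 1 := by rw [h₁.natDegree_fst]; ring
  have hdB : B.natDegree ≤ n ^ 2 + 2 * n := by
    have := h₁.natDegree_snd
    have e : (n + 1) ^ 2 = n ^ 2 + 2 * n + 1 := by ring
    omega
  have hdTB : (T * B).natDegree ≤ n ^ 2 + 2 * n := (natDegree_C_mul_le _ _).trans hdB
  have hdXA : (X * A).natDegree = n ^ 2 + 2 * n + 2 := by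
    rw [natDegree_X_mul h₁.monic.ne_zero, hdA]
  have hmS : (X * A - T * B).Monic := by
    refine (monic_X.mul h₁.monic).sub_of_left (degree_lt_degree ?_)
    omega
  have hdS : S₀.natDegree = 2 * n ^ 2 + 4 * n + 4 := by
    rw [hS₀, natDegree_pow, natDegree_sub_eq_left_of_natDegree_lt (by omega), hdXA]
    ring
  have hmA' : A'.Monic := h₀.monic.of_mul_monic_left (hA' ▸ hmS.pow 2)
  have hdA' : A'.natDegree = n ^ 2 + 4 * n + 4 := by
    rw [hA', h₀.monic.natDegree_mul hmA', h₀.natDegree_fst] at hdS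
    omega
  have hdXB : (X * B).natDegree ≤ n ^ 2 + 2 * n + 1 :=
    natDegree_mul_le_of_le natDegree_X_le hdB |>.trans (by omega)
  have hdS₁ : S₁.natDegree ≤ 2 * n ^ 2 + 4 * n + 3 := by
    have e₁ : ((A + X * B) * (T * B + X * A)).natDegree ≤ 2 * n ^ 2 + 4 * n + 3 :=
      (natDegree_mul_le_of_le (natDegree_add_le_of_degree_le hdA.le hdXB)
        (natDegree_add_le_of_degree_le (hdTB.trans (by omega)) hdXA.le)).trans (by omega)
    have e₂ : (2 * (1 + T) * X * A * B).natDegree ≤ 2 * n ^ 2 + 4 * n + 3 := by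
      have : 2 * (1 + T) * X * A * B = C (2 * (1 + algebraMap F K t)) * ((X * A) * B) := by
        simp only [map_mul, map_add, map_one, map_ofNat, hT]; ring
      rw [this]
      exact (natDegree_C_mul_le _ _).trans
        ((natDegree_mul_le_of_le hdXA.le hdB).trans (by omega))
    have e₃ : (2 : K[X]) = C 2 := (map_ofNat C 2).symm
    rw [hS₁, e₃]
    refine (natDegree_C_mul_le _ _).trans ?_
    rw [← e₃]
    exact (natDegree_sub_le _ _).trans (max_le e₁ e₂)
  have hdB' : B'.natDegree < (n + 2) ^ 2 := by
    by_cases h0 : B' = 0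
    · simp [h0]
    have hmul : (A₀ * B').natDegree = n ^ 2 + B'.natDegree := by
      rw [h₀.monic.natDegree_mul' h0, h₀.natDegree_fst]
    have hle : (A₀ * B').natDegree ≤ 2 * n ^ 2 + 4 * n + 3 := by
      have : A₀ * B' = S₁ - A' * B₀ := by rw [hsum]; ring
      rw [this]
      refine (natDegree_sub_le _ _).trans (max_le hdS₁ (natDegree_mul_le.trans ?_))
      have := h₀.natDegree_snd
      omega
    have e : (n + 2) ^ 2 = n ^ 2 + 4 * n + 4 := by ring
    omega
  refine ⟨A', B', hmA', by rw [hdA']; ring, hdB', fun x y h ↦ ?_⟩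
  obtain ⟨d, e, hd, he, hA₀, hB₀, hs₀, hs₁, hs₂⟩ := key x y h
  rw [hA', eval_mul, hA₀] at hs₀
  rw [hB', eval_mul, hB₀] at hs₂
  rw [hsum, eval_add, eval_mul, eval_mul, hA₀, hB₀] at hs₁
  have hne := Point.xRep_ne_zero (n • Point.some x y h)
  generalize (n • Point.some x y h).xRep = u at *
  generalize ((n + 2) • Point.some x y h).xRep = v at *
  have hα : (e * A'.eval x - d * v 0) * u 0 = 0 := by linear_combination hs₀
  have hβ : (e * B'.eval x - d * v 1) * u 1 = 0 := by linear_combination hs₂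
  have hαβ : (e * A'.eval x - d * v 0) * u 1 + (e * B'.eval x - d * v 1) * u 0 = 0 := by
    linear_combination hs₁
  have hzero : e * A'.eval x - d * v 0 = 0 ∧ e * B'.eval x - d * v 1 = 0 := by
    by_cases hu : u 0 = 0
    · have hu1 : u 1 ≠ 0 := fun hu1 ↦ hne (funext fun i ↦ by fin_cases i <;> assumption)
      simpa [hu, hu1, and_comm] using And.intro hαβ hβ
    · have h0 : e * A'.eval x - d * v 0 = 0 := by simpa [hu] using hα
      refine ⟨h0, ?_⟩
      simpa [h0, hu] using hαβ
  refine ⟨d / e, div_ne_zero hd he, ?_, ?_⟩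
  · field_simp
    linear_combination hzero.1
  · field_simp
    linear_combination hzero.2

lemma exists_isMulPair [IsAlgClosed K] (h2 : (2 : K) ≠ 0) (ht0 : t ≠ 0) (ht1 : t ≠ 1) {n : ℕ}
    (hn : n ≠ 0) : ∃ A B : K[X], IsMulPair t n A B := by
  suffices ∀ m : ℕ, (∃ A B : K[X], IsMulPair t (m + 1) A B) ∧
      ∃ A B : K[X], IsMulPair t (m + 2) A B by
    obtain ⟨m, rfl⟩ := Nat.exists_eq_succ_of_ne_zero hn
    exact (this m).1
  intro m
  induction m with
  | zero => exact ⟨⟨_, _, isMulPair_one⟩, ⟨_, _, isMulPair_two h2⟩⟩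
  | succ m ih =>
    obtain ⟨⟨A₀, B₀, h₀⟩, ⟨A, B, h₁⟩⟩ := ih
    exact ⟨⟨A, B, h₁⟩, h₀.exists_succ h2 ht0 ht1 m.succ_ne_zero h₁⟩

end legendreCurve

lemma FiniteField.sum_eval_algebraMap (L : Type*) {R : Type*} [Field L] [Fintype L] [CommRing R]
    [Algebra L R] (g : R[X]) (hg : g.natDegree < 2 * (Fintype.card L - 1)) :
    ∑ x : L, g.eval (algebraMap L R x) = -g.coeff (Fintype.card L - 1) := by
  classical
  set q := Fintype.card L
  have hq : 1 < q := Fintype.one_lt_card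
  have hpow (i : ℕ) (hi : i < 2 * (q - 1)) :
      ∑ x : L, x ^ i = if i = q - 1 then -1 else 0 := by
    split_ifs with h
    · rw [h, ← Finset.add_sum_erase _ _ (Finset.mem_univ 0), zero_pow (by omega), zero_add]
      rw [Finset.sum_congr rfl fun x hx ↦
        FiniteField.pow_card_sub_one_eq_one x (Finset.ne_of_mem_erase hx)]
      rw [Finset.sum_const, Finset.card_erase_of_mem (Finset.mem_univ _), Finset.card_univ,
        nsmul_one, Nat.cast_sub hq.le, Nat.cast_card_eq_zero]
      simp
    · rcases lt_or_ge i (q - 1) with h' | h'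
      · exact FiniteField.sum_pow_lt_card_sub_one L i h'
      · obtain ⟨j, rfl⟩ := Nat.exists_eq_add_of_le h'
        rw [← FiniteField.sum_pow_lt_card_sub_one L j (by omega)]
        refine Finset.sum_congr rfl fun x _ ↦ ?_
        rcases eq_or_ne x 0 with rfl | hx
        · rw [zero_pow (by omega), zero_pow (by omega)]
        · rw [pow_add, FiniteField.pow_card_sub_one_eq_one x hx, one_mul]
  simp_rw [eval_eq_sum_range' hg]
  rw [Finset.sum_comm]
  simp_rw [← Finset.mul_sum, ← map_pow, ← map_sum]
  rw [Finset.sum_congr rfl fun i hi ↦ by rw [hpow i (Finset.mem_range.1 hi)],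
    Finset.sum_eq_single (q - 1)]
  · simp
  · intro i _ hi
    simp [hi]
  · intro h
    simp only [Finset.mem_range] at h
    omega

/-- The right-hand side `x(x - 1)(x - a)` of the equation of the Legendre curve. -/
noncomputable def legendreCubic {R : Type*} [CommRing R] (a : R) : R[X] :=
  X * (X - 1) * (X - C a)

lemma eval_legendreCubic {R : Type*} [CommRing R] (a x : R) :
    (legendreCubic a).eval x = x * (x - 1) * (x - a) := by
  simp [legendreCubic]

lemma map_legendreCubic {R S : Type*} [CommRing R] [CommRing S] (f : R →+* S) (a : R) :
    (legendreCubic a).map f = legendreCubic (f a) := by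
  simp [legendreCubic]

lemma natDegree_legendreCubic_pow_le {R : Type*} [CommRing R] (a : R) (n : ℕ) :
    (legendreCubic a ^ n).natDegree ≤ 3 * n := by
  have : (legendreCubic a).natDegree ≤ 3 := by
    rw [legendreCubic]
    compute_degree
  rw [mul_comm]
  exact natDegree_pow_le_of_le n this

lemma coeff_legendreCubic_pow_eq_zero {L : Type*} [Field L] {p : ℕ} [Fact p.Prime] [CharP L p]
    (hp : p ≠ 2) {a : L} (ha : (legendreCubic a ^ ((p - 1) / 2)).coeff (p - 1) = 0) (s : ℕ) :
    (legendreCubic a ^ (p ^ (s + 1) / 2)).coeff (p ^ (s + 1) - 1) = 0 := by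
  have hodd : Odd p := (Fact.out : p.Prime).odd_of_ne_two hp
  obtain ⟨m, hm⟩ := id hodd
  obtain ⟨M, hM⟩ := hodd.pow (n := s)
  have hp1 := (Fact.out : p.Prime).one_lt
  have hexp : p ^ (s + 1) / 2 = (p - 1) / 2 + M * p := by
    have e : p ^ (s + 1) = 2 * (m + M * p) + 1 := by
      rw [pow_succ, hM, add_mul, one_mul]
      nth_rw 2 [hm]
      ring
    have e' : (p - 1) / 2 = m := by omega
    rw [e, e']
    omega
  rw [hexp, pow_add, pow_mul _ M p, ← map_frobenius_expand (p := p), coeff_mul]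
  refine Finset.sum_eq_zero fun ij hij ↦ ?_
  rw [Finset.HasAntidiagonal.mem_antidiagonal] at hij
  rw [map_expand, coeff_expand (by omega)]
  split_ifs with hdvd
  swap
  · rw [mul_zero]
  rcases lt_or_ge (3 * ((p - 1) / 2)) ij.1 with hlt | hle
  · rw [coeff_eq_zero_of_natDegree_lt ((natDegree_legendreCubic_pow_le _ _).trans_lt hlt), zero_mul]
  have hdvd' : p ∣ ij.1 + 1 := by
    have h1 : p ∣ p ^ (s + 1) := dvd_pow_self p s.succ_ne_zero
    have h2 : 0 < p ^ (s + 1) := by positivity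
    rw [show p ^ (s + 1) = (ij.1 + 1) + ij.2 by omega] at h1
    exact (Nat.dvd_add_left hdvd).1 h1
  obtain ⟨k, hk⟩ := hdvd'
  have hk1 : k = 1 := by
    have hk0 : k ≠ 0 := by rintro rfl; simp at hk
    have hk2 : p * k < p * 2 := by omega
    have := lt_of_mul_lt_mul_left hk2 (Nat.zero_le p)
    omega
  rw [show ij.1 = p - 1 by rw [hk1] at hk; omega, ha, zero_mul]

namespace legendreCurve

variable {F L : Type*} [Field F] [Field L] [Algebra F L] {t : F}

lemma natCast_card_point [Fintype L] (h2 : (2 : L) ≠ 0) (ht0 : t ≠ 0) (ht1 : t ≠ 1) :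
    (Nat.card ((legendreCurve t)⁄L).Point : L) =
      1 + ∑ x : L, (legendreCubic (algebraMap F L t) ^ (Fintype.card L / 2)).eval x := by
  classical
  have hchar : ringChar L ≠ 2 := fun h ↦ h2 (by exact_mod_cast (ringChar.spec L 2).2 h.dvd)
  let e : {xy : L × L // ((legendreCurve t)⁄L).Nonsingular xy.1 xy.2} ≃
      Σ x : L, {y : L // y ^ 2 = (legendreCubic (algebraMap F L t)).eval x} :=
    { toFun xy := ⟨xy.1.1, xy.1.2, by
        rw [eval_legendreCubic]; exact (equation_iff t).1 xy.2.1⟩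
      invFun xy := ⟨⟨xy.1, xy.2.1⟩, nonsingular_of_sq_eq h2 ht0 ht1 (by
        rw [← eval_legendreCubic]; exact xy.2.2)⟩
      left_inv _ := rfl
      right_inv _ := rfl }
  have hcard : Nat.card ((legendreCurve t)⁄L).Point =
      1 + ∑ x : L, Nat.card {y : L // y ^ 2 = (legendreCubic (algebraMap F L t)).eval x} := by
    rw [Nat.card_congr (nonsingularPointEquiv _), WithZero, Finite.card_option, Nat.card_congr e,
      Nat.card_sigma, add_comm]
  rw [hcard, Nat.cast_add, Nat.cast_one, Nat.cast_sum]
  have hterm (x : L) :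
      (Nat.card {y : L // y ^ 2 = (legendreCubic (algebraMap F L t)).eval x} : L) =
        (legendreCubic (algebraMap F L t) ^ (Fintype.card L / 2)).eval x + 1 := by
    rw [eval_pow, ← quadraticChar_eq_pow_of_char_ne_two' hchar]
    have := quadraticChar_card_sqrts hchar ((legendreCubic (algebraMap F L t)).eval x)
    rw [← Int.cast_one, ← Int.cast_add, ← this, Int.cast_natCast, Set.toFinset_card,
      Nat.card_eq_fintype_card]
    rfl
  simp_rw [hterm, Finset.sum_add_distrib]
  simp

lemma natCast_card_point_eq_one [Finite L] {p : ℕ} [Fact p.Prime] [CharP L p] (hp : p ≠ 2)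
    (ht0 : t ≠ 0) (ht1 : t ≠ 1)
    (hss : (legendreCubic t ^ ((p - 1) / 2)).coeff (p - 1) = 0) :
    (Nat.card ((legendreCurve t)⁄L).Point : L) = 1 := by
  have := Fintype.ofFinite L
  obtain ⟨n, -, hn⟩ := FiniteField.card L p
  have h2 : (2 : L) ≠ 0 := fun h ↦ by
    have h' : p ∣ 2 := (CharP.cast_eq_zero_iff L p 2).1 (by exact_mod_cast h)
    exact hp ((Nat.prime_dvd_prime_iff_eq Fact.out Nat.prime_two).1 h')
  have hss' : (legendreCubic (algebraMap F L t) ^ ((p - 1) / 2)).coeff (p - 1) = 0 := by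
    rw [← map_legendreCubic, ← Polynomial.map_pow, coeff_map, hss, map_zero]
  rw [natCast_card_point h2 ht0 ht1]
  have hsum := FiniteField.sum_eval_algebraMap L
    (legendreCubic (algebraMap F L t) ^ (Fintype.card L / 2)) <|
    (natDegree_legendreCubic_pow_le _ _).trans_lt <| by
      have h3 : 2 < Fintype.card L := by
        rw [hn]
        exact ((Fact.out : p.Prime).two_le.lt_of_ne hp.symm).trans_le
          (Nat.le_self_pow n.ne_zero p)
      have hodd : Odd (Fintype.card L) :=
        hn ▸ ((Fact.out : p.Prime).odd_of_ne_two hp).pow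
      obtain ⟨k, hk⟩ := hodd
      omega
  simp only [Algebra.algebraMap_self, RingHom.id_apply] at hsum
  obtain ⟨s, hs⟩ := Nat.exists_eq_succ_of_ne_zero n.ne_zero
  rw [hsum, hn, hs, coeff_legendreCubic_pow_eq_zero hp hss', neg_zero, add_zero]

end legendreCurve

lemma two_ne_zero_of_charP_ne_two (R : Type*) [CommRing R] [Nontrivial R] (p : ℕ) [CharP R p]
    [Fact p.Prime] (hp : p ≠ 2) : (2 : R) ≠ 0 := fun h ↦ by
  have h' : p ∣ 2 := (CharP.cast_eq_zero_iff R p 2).1 (by exact_mod_cast h)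
  exact hp ((Nat.prime_dvd_prime_iff_eq Fact.out Nat.prime_two).1 h')

lemma Polynomial.Monic.eq_X_sub_C_pow {K : Type*} [Field K] [IsAlgClosed K] {f : K[X]}
    (hf : f.Monic) {a : K} (h : ∀ x, f.eval x = 0 → x = a) : f = (X - C a) ^ f.natDegree := by
  have hroots : f.roots = Multiset.replicate f.natDegree a :=
    Multiset.eq_replicate.2 ⟨(IsAlgClosed.splits f).natDegree_eq_card_roots.symm,
      fun x hx ↦ h x (isRoot_of_mem_roots hx)⟩
  conv_lhs => rw [(IsAlgClosed.splits f).eq_prod_roots_of_monic hf, hroots]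
  simp

namespace legendreCurve

section

variable {F K : Type*} [Field F] [Field K] [Algebra F K] {t : F} [DecidableEq K]

lemma eq_zero_of_nsmul_eq_zero [Finite F] [Algebra.IsAlgebraic F K] {p : ℕ} [Fact p.Prime]
    [CharP F p] (hp : p ≠ 2) (ht0 : t ≠ 0) (ht1 : t ≠ 1)
    (hss : (legendreCubic t ^ ((p - 1) / 2)).coeff (p - 1) = 0)
    {P : ((legendreCurve t)⁄K).Point} (hP : p • P = 0) : P = 0 := by
  classical
  match P with
  | 0 => rfl
  | .some x y h =>
    exfalso
    let L := IntermediateField.adjoin F {x, y}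
    have : FiniteDimensional F L :=
      IntermediateField.finiteDimensional_adjoin fun z _ ↦ Algebra.IsIntegral.isIntegral z
    have : Finite L := Module.finite_of_finite F
    have : CharP L p := charP_of_injective_algebraMap (algebraMap F L).injective p
    have hx : x ∈ L := IntermediateField.subset_adjoin F _ (by simp)
    have hy : y ∈ L := IntermediateField.subset_adjoin F _ (by simp)
    have h' : ((legendreCurve t)⁄L).Nonsingular ⟨x, hx⟩ ⟨y, hy⟩ :=
      ((legendreCurve t).toAffine.baseChange_nonsingular L.val.injective _ _).1 h
    have hQ : Point.map L.val (.some _ _ h') = Point.some x y h := rfl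
    have hQ0 : p • Point.some _ _ h' = 0 :=
      Point.map_injective L.val (by rw [map_nsmul, hQ, hP, map_zero])
    have hdvd : p ∣ Nat.card ((legendreCurve t)⁄L).Point := by
      rw [← addOrderOf_eq_prime hQ0 (Point.some_ne_zero h')]
      exact addOrderOf_dvd_natCard _
    have := natCast_card_point_eq_one (L := L) hp ht0 ht1 hss
    rw [(CharP.cast_eq_zero_iff L p _).2 hdvd] at this
    exact zero_ne_one this

end

section

variable {F K : Type*} [Field F] [Fintype F] [Field K] [Algebra F K] {t : F} [DecidableEq K]
  [Algebra.IsAlgebraic F K] [IsAlgClosed K]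

lemma nsmul_eq_or_eq_neg_frobenius {p : ℕ} [Fact p.Prime] [CharP F p] (hF : Fintype.card F = p ^ 2)
    (hp : p ≠ 2) (ht0 : t ≠ 0) (ht1 : t ≠ 1)
    (hss : (legendreCubic t ^ ((p - 1) / 2)).coeff (p - 1) = 0)
    (P : ((legendreCurve t)⁄K).Point) :
    p • P = Point.map (FiniteField.frobeniusAlgHom F K) P ∨
      p • P = -Point.map (FiniteField.frobeniusAlgHom F K) P := by
  have : CharP K p := charP_of_injective_algebraMap (algebraMap F K).injective p
  have h2 := two_ne_zero_of_charP_ne_two K p hp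
  have hp0 := (Fact.out : p.Prime).ne_zero
  obtain ⟨A, B, hAB⟩ := exists_isMulPair (K := K) h2 ht0 ht1 hp0
  have htors {P : ((legendreCurve t)⁄K).Point} (hP : p • P = 0) : P = 0 :=
    eq_zero_of_nsmul_eq_zero hp ht0 ht1 hss hP
  have hBroot (x : K) : B.eval x ≠ 0 := by
    obtain ⟨y, hy⟩ := exists_nonsingular h2 ht0 ht1 x
    obtain ⟨c, hc, -, hB⟩ := hAB.eval x y hy
    rw [hB]
    refine mul_ne_zero hc ?_
    have hne : p • Point.some x y hy ≠ 0 := fun h ↦ Point.some_ne_zero hy (htors h)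
    generalize p • Point.some x y hy = Q at hne
    match Q with
    | 0 => exact absurd rfl hne
    | .some _ _ _ => simp
  obtain ⟨b, hb⟩ : ∃ b, B = C b := by
    refine ⟨_, eq_C_of_degree_eq_zero ?_⟩
    by_contra h
    obtain ⟨x, hx⟩ := IsAlgClosed.exists_root B h
    exact hBroot x hx
  have hb0 : b ≠ 0 := by simpa [hb] using hBroot 0
  have hxRep (x y : K) (h : ((legendreCurve t)⁄K).Nonsingular x y) :
      (p • Point.some x y h).xRep = ![A.eval x / b, 1] := by
    obtain ⟨c, hc, hA, hB⟩ := hAB.eval x y h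
    rw [hb, eval_C] at hB
    generalize p • Point.some x y h = Q at *
    match Q with
    | 0 => simp [hb0] at hB
    | .some x' y' h' =>
      simp only [Point.xRep_some, Matrix.cons_val_zero, Matrix.cons_val_one, mul_one] at hA hB ⊢
      rw [hA, hB, mul_div_cancel_left₀ _ hc]
  have hfiber (e : K) (he : e * (e - 1) = 0) (x : K) (hx : A.eval x = e * b) : x = e := by
    have hZ : ((legendreCurve t)⁄K).Nonsingular e 0 :=
      nonsingular_of_sq_eq h2 ht0 ht1 (by rw [he]; ring)
    have hnegZ : -Point.some e 0 hZ = .some e 0 hZ := by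
      rw [Point.neg_some]
      congr 1
      rw [negY_eq, neg_zero]
    have hpZ : p • Point.some e 0 hZ = .some e 0 hZ := by
      obtain ⟨m, hm⟩ := (Fact.out : p.Prime).odd_of_ne_two hp
      have h0 : 2 • Point.some e 0 hZ = 0 := by
        rw [two_smul]
        nth_rw 1 [← hnegZ]
        exact neg_add_cancel _
      rw [hm, succ_nsmul, mul_comm, mul_nsmul', h0, nsmul_zero, zero_add]
    obtain ⟨y, hy⟩ := exists_nonsingular h2 ht0 ht1 x
    have hrep : (p • Point.some x y hy).xRep = (Point.some e 0 hZ).xRep := by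
      rw [hxRep, hx, Point.xRep_some, mul_div_cancel_right₀ _ hb0]
    have hpP : p • Point.some x y hy = .some e 0 hZ := by
      rcases Point.eq_or_eq_neg_of_xRep_eq_xRep hrep with h | h
      · exact h
      · rw [h, hnegZ]
    have := htors (P := .some x y hy - .some e 0 hZ) (by rw [nsmul_sub, hpP, hpZ, sub_self])
    exact (Point.some.inj (sub_eq_zero.1 this)).1
  have hA : A = X ^ p ^ 2 := by
    have := hAB.monic.eq_X_sub_C_pow (a := 0) fun x hx ↦ hfiber 0 (by simp) x (by simpa using hx)
    rwa [C_0, sub_zero, hAB.natDegree_fst] at this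
  have hb1 : b = 1 := by
    have hmonic : (X ^ p ^ 2 - C b).Monic := monic_X_pow_sub_C b (pow_ne_zero 2 hp0)
    have := hmonic.eq_X_sub_C_pow (a := 1) fun x hx ↦ hfiber 1 (by simp) x (by
      rw [hA]
      rw [eval_sub, eval_C, sub_eq_zero] at hx
      rw [hx, one_mul])
    have := congrArg (eval 1) this
    rw [natDegree_X_pow_sub_C] at this
    simp only [eval_sub, eval_pow, eval_X, one_pow, eval_C, sub_self,
      zero_pow (pow_ne_zero 2 hp0)] at this
    exact (sub_eq_zero.1 this).symm
  match P with
  | 0 => left; rw [nsmul_zero, map_zero]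
  | .some x y h =>
    refine Point.eq_or_eq_neg_of_xRep_eq_xRep ?_
    rw [hxRep, Point.map_some, Point.xRep_some, hA, hb1]
    simp [hF]

end

end legendreCurve

lemma FiniteField.exists_algebraMap_eq_of_pow_card_eq {F K : Type*} [Field F] [Fintype F] [Field K]
    [Algebra F K] {r : K} (hr : r ^ Fintype.card F = r) : ∃ u : F, algebraMap F K u = r := by
  classical
  have hne : (X ^ Fintype.card F - X : K[X]) ≠ 0 :=
    FiniteField.X_pow_card_sub_X_ne_zero K Fintype.one_lt_card
  have hsub : Finset.univ.image (algebraMap F K) ⊆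
      (X ^ Fintype.card F - X : K[X]).roots.toFinset := by
    intro x hx
    obtain ⟨a, -, rfl⟩ := Finset.mem_image.1 hx
    rw [Multiset.mem_toFinset, mem_roots hne]
    simp [← map_pow, FiniteField.pow_card]
  have hcard : (X ^ Fintype.card F - X : K[X]).roots.toFinset.card ≤
      (Finset.univ.image (algebraMap F K)).card := by
    rw [Finset.card_image_of_injective _ (algebraMap F K).injective, Finset.card_univ]
    calc _ ≤ _ := Multiset.toFinset_card_le _
      _ ≤ _ := card_roots' _
      _ = _ := FiniteField.X_pow_card_sub_X_natDegree_eq K Fintype.one_lt_card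
  have hmem : r ∈ (X ^ Fintype.card F - X : K[X]).roots.toFinset := by
    rw [Multiset.mem_toFinset, mem_roots hne]
    simp [hr]
  rw [← Finset.eq_of_subset_of_card_le hsub hcard] at hmem
  obtain ⟨u, -, hu⟩ := Finset.mem_image.1 hmem
  exact ⟨u, hu⟩

lemma exists_sq_eq_eight_mul_add_one {p : ℕ} (hp : Odd p) : ∃ k, p ^ 2 = 8 * k + 1 := by
  obtain ⟨k, hk⟩ := Nat.eight_dvd_sq_sub_one_of_odd hp
  have := pow_pos hp.pos 2
  exact ⟨k, by omega⟩

lemma exists_pow_four_eq_neg_one {F : Type*} [Field F] [Fintype F] {p : ℕ} (hp : Odd p)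
    (hF : Fintype.card F = p ^ 2) : ∃ z : F, z ^ 4 = -1 := by
  obtain ⟨z, hz⟩ := IsAlgClosed.exists_pow_nat_eq (-1 : AlgebraicClosure F) four_pos
  obtain ⟨k, hk⟩ := exists_sq_eq_eight_mul_add_one hp
  have hz8 : z ^ 8 = 1 := by
    rw [show 8 = 4 * 2 from rfl, pow_mul, hz]
    ring
  obtain ⟨u, hu⟩ := FiniteField.exists_algebraMap_eq_of_pow_card_eq (F := F) (r := z) (by
    rw [hF, hk, pow_succ, pow_mul, hz8, one_pow, one_mul])
  refine ⟨u, (algebraMap F (AlgebraicClosure F)).injective ?_⟩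
  rw [map_pow, hu, hz, map_neg, map_one]

lemma coeff_legendreCubic_one_sub_pow {F : Type*} [Field F] {p : ℕ} [Fact p.Prime] [CharP F p]
    (a : F) :
    (legendreCubic (1 - a) ^ ((p - 1) / 2)).coeff (p - 1) =
      (-1) ^ ((p - 1) / 2) * (legendreCubic a ^ ((p - 1) / 2)).coeff (p - 1) := by
  let := ZMod.algebra F p
  have hsum (b : F) := FiniteField.sum_eval_algebraMap (ZMod p) (legendreCubic b ^ ((p - 1) / 2))
    ((natDegree_legendreCubic_pow_le _ _).trans_lt (by
      have := (Fact.out : p.Prime).two_le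
      rw [ZMod.card]
      omega))
  simp only [ZMod.card] at hsum
  rw [← neg_inj, ← mul_neg, ← hsum, ← hsum, Finset.mul_sum,
    ← Equiv.sum_comp (Equiv.subLeft (1 : ZMod p))]
  refine Finset.sum_congr rfl fun x _ ↦ ?_
  rw [eval_pow, eval_pow, ← mul_pow, eval_legendreCubic, eval_legendreCubic, Equiv.subLeft_apply,
    map_sub, map_one]
  ring

namespace legendreCurve

variable {F K : Type*} [Field F] [Field K] [Algebra F K] {t : F} [DecidableEq K]

lemma exists_two_nsmul_eq_some (h2 : (2 : K) ≠ 0) {x y a : K}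
    (h : ((legendreCurve t)⁄K).Nonsingular x y) (hy : y ≠ 0)
    (ha : (x ^ 2 - algebraMap F K t) ^ 2 = 4 * y ^ 2 * a) :
    ∃ b hb, 2 • Point.some x y h = .some a b hb := by
  have h4 : (4 : K) ≠ 0 := by
    rw [show (4 : K) = 2 * 2 by norm_num]
    exact mul_ne_zero h2 h2
  obtain ⟨d, hd, h₀, h₁, -⟩ := xRep_add_sub h2 h (.some x y h)
  have hP := (equation_iff t).1 h.1
  rw [sub_self, ← two_nsmul, Point.xRep_zero, Point.xRep_some] at h₀ h₁
  generalize 2 • Point.some x y h = Q at *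
  match Q with
  | 0 =>
    simp only [Point.xRep_zero, Matrix.cons_val_zero, Matrix.cons_val_one] at h₁
    have : 4 * y ^ 2 = 0 := by linear_combination 4 * hP + h₁
    simp [h4, hy] at this
  | .some a' b hb =>
    simp only [Point.xRep_some, Matrix.cons_val_zero, Matrix.cons_val_one] at h₀ h₁
    have hd' : d = 4 * y ^ 2 := by linear_combination -4 * hP - h₁
    have : d * a' = d * a := by linear_combination ha - h₀ - a * hd'
    obtain rfl := mul_left_cancel₀ hd this
    exact ⟨b, hb, rfl⟩

lemma exists_four_nsmul_eq [IsAlgClosed K] (h2 : (2 : K) ≠ 0) (ht0 : t ≠ 0) (ht1 : t ≠ 1) {s : K}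
    (hs : s ^ 2 = algebraMap F K t) :
    ∃ (x y : K) (h : ((legendreCurve t)⁄K).Nonsingular x y), x ≠ 0 ∧ y ≠ 0 ∧
      (x ^ 2 - algebraMap F K t) ^ 2 = 4 * y ^ 2 * s ∧
      (∃ b hb, b ≠ 0 ∧ 2 • Point.some x y h = .some s b hb) ∧
      ∃ h₀, 4 • Point.some x y h = .some 0 0 h₀ := by
  have h4 : (4 : K) ≠ 0 := by
    rw [show (4 : K) = 2 * 2 by norm_num]
    exact mul_ne_zero h2 h2
  have hT0 : algebraMap F K t ≠ 0 := by simpa using ht0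
  have hT1 : algebraMap F K t ≠ 1 := by simpa using ht1
  have hs0 : s ≠ 0 := by rintro rfl; exact hT0 (by rw [← hs]; ring)
  have hs1 : s ≠ 1 := by rintro rfl; exact hT1 (by rw [← hs]; ring)
  set T := algebraMap F K t
  obtain ⟨x, hx⟩ := IsAlgClosed.exists_root
    ((X ^ 2 - C T) ^ 2 - C (4 * s) * (X * (X - 1) * (X - C T)) : K[X]) (by
      have : degree ((X ^ 2 - C T) ^ 2 - C (4 * s) * (X * (X - 1) * (X - C T)) : K[X]) = 4 := by
        compute_degree!
      rw [this]
      norm_num)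
  obtain ⟨y, hy⟩ := IsAlgClosed.exists_pow_nat_eq (x * (x - 1) * (x - T)) two_pos
  simp only [IsRoot.def, eval_sub, eval_mul, eval_pow, eval_X, eval_C, eval_one] at hx
  have hxy : (x ^ 2 - T) ^ 2 = 4 * y ^ 2 * s := by rw [hy]; linear_combination hx
  have hy0 : y ≠ 0 := by
    rintro rfl
    have hxT : x ^ 2 = T := by
      rw [zero_pow two_ne_zero, mul_zero, zero_mul] at hxy
      exact sub_eq_zero.1 (pow_eq_zero_iff two_ne_zero |>.1 hxy)
    have h3 : x = 0 ∨ x = 1 ∨ x = T := by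
      rw [zero_pow two_ne_zero, eq_comm] at hy
      simpa [sub_eq_zero, or_assoc] using hy
    rcases h3 with h | h | h
    · exact hT0 (by rw [← hxT, h]; ring)
    · exact hT1 (by rw [← hxT, h]; ring)
    · rw [h, sq] at hxT
      exact hT1 (mul_left_cancel₀ hT0 (by rw [hxT, mul_one]))
  have hx0 : x ≠ 0 := by
    rintro rfl
    exact hy0 (by simpa using hy)
  have h := nonsingular_of_sq_eq h2 ht0 ht1 hy
  obtain ⟨b, hb, hQ⟩ := exists_two_nsmul_eq_some h2 h hy0 hxy
  have hbs : b ^ 2 = -(s * (s - 1)) ^ 2 := by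
    rw [(equation_iff t).1 hb.1]
    change s * (s - 1) * (s - T) = _
    rw [← hs]
    ring
  have hb0 : b ≠ 0 := by
    rintro rfl
    have : s * (s - 1) = 0 := by simpa using hbs
    simp [hs0, sub_eq_zero, hs1] at this
  obtain ⟨c, hc, hZ⟩ := exists_two_nsmul_eq_some (a := 0) h2 hb hb0 (by
    change (s ^ 2 - T) ^ 2 = _
    rw [hs]
    ring)
  have hc0 : c = 0 := by simpa using (equation_iff t).1 hc.1
  subst hc0
  refine ⟨x, y, h, hx0, hy0, hxy, ⟨b, hb, hb0, hQ⟩, hc, ?_⟩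
  rw [← hZ, ← hQ, ← mul_nsmul]

lemma add_some_zero_zero {x y : K} (h : ((legendreCurve t)⁄K).Nonsingular x y)
    (h₀ : ((legendreCurve t)⁄K).Nonsingular 0 0) (hx : x ≠ 0) :
    ∃ h', Point.some x y h + .some 0 0 h₀ =
      .some (algebraMap F K t / x) (-(algebraMap F K t * y / x ^ 2)) h' := by
  have hP := (equation_iff t).1 h.1
  have hX : ((legendreCurve t)⁄K).addX x 0 (((legendreCurve t)⁄K).slope x 0 y 0) =
      algebraMap F K t / x := by
    rw [slope_of_X_ne hx, addX, a₁_baseChange, a₂_baseChange]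
    simp only [sub_zero]
    field_simp
    linear_combination hP
  have hY : ((legendreCurve t)⁄K).addY x 0 y (((legendreCurve t)⁄K).slope x 0 y 0) =
      -(algebraMap F K t * y / x ^ 2) := by
    rw [addY, negAddY, hX, slope_of_X_ne hx, negY_eq]
    simp only [sub_zero]
    field_simp
    ring
  rw [Point.add_of_X_ne hx]
  exact ⟨hX ▸ hY ▸ nonsingular_add h h₀ fun hxy ↦ hx hxy.1, (Point.some.injEq ..).mpr ⟨hX, hY⟩⟩

end legendreCurve

lemma eq_or_eq_add_four_nsmul_of_odd {G : Type*} [AddCommGroup G] {p : ℕ} (hp : Odd p) {R S : G}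
    (h8 : 8 • R = 0) (hS : p • R = S ∨ p • R = -S) (h2 : 2 • S + 2 • R ≠ 0) :
    S = R ∨ S = R + 4 • R := by
  have hmod : p • R = (p % 8) • R := by
    conv_lhs => rw [← Nat.mod_add_div p 8, add_nsmul, mul_nsmul, h8, nsmul_zero, add_zero]
  have h1 : p % 8 = 1 ∨ p % 8 = 3 ∨ p % 8 = 5 ∨ p % 8 = 7 := by
    obtain ⟨k, hk⟩ := hp
    omega
  rw [hmod] at hS
  clear hmod
  have hneg {k l : ℕ} (hkl : k + l = 8) (h : k • R = -S) : l • R = S := by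
    rw [← sub_eq_zero, ← add_left_cancel_iff (a := k • R), ← add_sub_assoc, ← add_nsmul, hkl, h8, h]
    abel
  have hS' : S = 1 • R ∨ S = 3 • R ∨ S = 5 • R ∨ S = 7 • R := by
    rcases h1 with h | h | h | h <;> rw [h] at hS <;> rcases hS with hS | hS
    · exact .inl hS.symm
    · exact .inr (.inr (.inr (hneg (by norm_num) hS).symm))
    · exact .inr (.inl hS.symm)
    · exact .inr (.inr (.inl (hneg (by norm_num) hS).symm))
    · exact .inr (.inr (.inl hS.symm))
    · exact .inr (.inl (hneg (by norm_num) hS).symm)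
    · exact .inr (.inr (.inr hS.symm))
    · exact .inl (hneg (by norm_num) hS).symm
  rcases hS' with h | h | h | h
  · exact .inl (by rw [h, one_nsmul])
  · refine absurd ?_ h2
    rw [h, ← mul_nsmul, ← add_nsmul, h8]
  · exact .inr (by rw [h, succ_nsmul'])
  · refine absurd ?_ h2
    rw [h, ← mul_nsmul, ← add_nsmul, show 7 * 2 + 2 = 8 * 2 from rfl, mul_nsmul, h8, nsmul_zero]

namespace legendreCurve

theorem exists_eq_pow_four {F : Type*} [Field F] [Fintype F] (K : Type*) [Field K] [Algebra F K]
    [Algebra.IsAlgebraic F K] [IsAlgClosed K] {p : ℕ} [Fact p.Prime] [CharP F p]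
    (hF : Fintype.card F = p ^ 2) (hp : p ≠ 2) {t : F} (ht0 : t ≠ 0) (ht1 : t ≠ 1)
    (hss : (legendreCubic t ^ ((p - 1) / 2)).coeff (p - 1) = 0) : ∃ u, t = u ^ 4 := by
  classical
  have : CharP K p := charP_of_injective_algebraMap (algebraMap F K).injective p
  have h2 := two_ne_zero_of_charP_ne_two K p hp
  have hodd := (Fact.out : p.Prime).odd_of_ne_two hp
  have hT0 : algebraMap F K t ≠ 0 := by simpa using ht0
  obtain ⟨s, hs⟩ := IsAlgClosed.exists_pow_nat_eq (algebraMap F K t) two_pos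
  obtain ⟨x, y, h, hx0, hy0, hxy, ⟨b, hb, hb0, hQ⟩, h₀, hZ⟩ :=
    exists_four_nsmul_eq h2 ht0 ht1 hs
  set R := Point.some x y h with hR
  let σ := FiniteField.frobeniusAlgHom F K
  have hσ (a : K) : σ a = a ^ Fintype.card F := rfl
  have hneg : -Point.some 0 0 h₀ = .some 0 0 h₀ := by
    rw [Point.neg_some]
    congr 1
    rw [negY_eq, neg_zero]
  have h8 : 8 • R = 0 := by
    rw [show 8 = 4 + 4 from rfl, add_nsmul, hZ]
    nth_rw 1 [← hneg]
    exact neg_add_cancel _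
  have hfrob := nsmul_eq_or_eq_neg_frobenius hF hp ht0 ht1 hss R
  have hσR : 2 • Point.map σ R + 2 • R ≠ 0 := by
    intro he
    rw [← map_nsmul, hQ] at he
    have he' := eq_neg_of_add_eq_zero_left he
    rw [Point.map_some, Point.neg_some] at he'
    replace he' := (Point.some.injEq ..).mp he'
    rw [negY_eq] at he'
    have hs0 : s ≠ 0 := by rintro rfl; exact hT0 (by rw [← hs]; ring)
    have hs1 : s - 1 ≠ 0 := by
      rw [sub_ne_zero]
      rintro rfl
      exact ht1 ((algebraMap F K).injective (by rw [← hs]; simp))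
    have hbs : (b / (s * (s - 1))) ^ 2 = -1 := by
      field_simp
      rw [(equation_iff t).1 hb.1, ← hs]
      ring
    have hw : σ (b / (s * (s - 1))) = b / (s * (s - 1)) := by
      obtain ⟨k, hk⟩ := exists_sq_eq_eight_mul_add_one hodd
      rw [hσ, hF, hk, show 8 * k + 1 = 2 * (2 * (2 * k)) + 1 by ring, pow_succ, pow_mul, hbs,
        pow_mul, neg_one_sq, one_pow, one_mul]
    rw [map_div₀, map_mul, map_sub, map_one, he'.1, he'.2] at hw
    field_simp at hw
    exact h2 (by linear_combination -hw)
  have hr : σ ((x ^ 2 - algebraMap F K t) / (2 * y)) = (x ^ 2 - algebraMap F K t) / (2 * y) := by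
    rw [map_div₀, map_mul, map_sub, map_pow, AlgHom.commutes, map_ofNat]
    rcases eq_or_eq_add_four_nsmul_of_odd hodd h8 hfrob hσR with he | he
    · rw [hR, Point.map_some] at he
      obtain ⟨hx, hy⟩ := (Point.some.injEq ..).mp he
      rw [hx, hy]
    · obtain ⟨h', hadd⟩ := add_some_zero_zero h h₀ hx0
      rw [hZ, hR, hadd, Point.map_some] at he
      obtain ⟨hx, hy⟩ := (Point.some.injEq ..).mp he
      rw [hx, hy]
      field_simp
      ring
  obtain ⟨u, hu⟩ := FiniteField.exists_algebraMap_eq_of_pow_card_eq ((hσ _).symm.trans hr)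
  refine ⟨u, (algebraMap F K).injective ?_⟩
  have hr2 : ((x ^ 2 - algebraMap F K t) / (2 * y)) ^ 2 = s := by
    rw [div_pow, hxy, div_eq_iff (pow_ne_zero 2 (mul_ne_zero h2 hy0))]
    ring
  rw [map_pow, hu, show 4 = 2 * 2 from rfl, pow_mul, hr2, hs]

end legendreCurve

end

theorem stmt_16 (p : ℕ) [Fact p.Prime] (hp : p ≠ 2)
    (t : GaloisField p 2) (ht0 : t ≠ 0) (ht1 : t ≠ 1)
    (hss : ((Polynomial.X * (Polynomial.X - 1) * (Polynomial.X - Polynomial.C t))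
        ^ ((p - 1) / 2)).coeff (p - 1) = 0) :
    (∃ u : GaloisField p 2, t = u ^ 4) ∧ (∃ u : GaloisField p 2, 1 - t = u ^ 4) ∧
      (∃ u : GaloisField p 2, -t = u ^ 4) := by
  have := Fintype.ofFinite (GaloisField p 2)
  have hF : Fintype.card (GaloisField p 2) = p ^ 2 := by
    rw [← Nat.card_eq_fintype_card, GaloisField.card p 2 two_ne_zero]
  have key {a : GaloisField p 2} := legendreCurve.exists_eq_pow_four
    (AlgebraicClosure (GaloisField p 2)) hF hp (t := a)
  obtain ⟨u, hu⟩ := key ht0 ht1 hss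
  refine ⟨⟨u, hu⟩, ?_, ?_⟩
  · refine key (sub_ne_zero.2 ht1.symm) (by simpa using ht0) ?_
    rw [coeff_legendreCubic_one_sub_pow, legendreCubic, hss, mul_zero]
  · obtain ⟨z, hz⟩ := exists_pow_four_eq_neg_one ((Fact.out : p.Prime).odd_of_ne_two hp) hF
    exact ⟨z * u, by rw [mul_pow, hz, ← hu, neg_one_mul]⟩
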